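/- Let ~ be the equivalence relation on the unit cube [0,1]^3 generated by: p ~ f1(p) for all p in the top face [0,1]^2 × {1}, p ~ f2(p) for all p in the front face [0,1] × {0} × [0,1], and p ~ f3(p) for all p in the left face {0} × [0,1] × [0,1], where f1(x,y,z) = (1-y,1-x,1-z), f2(x,y,z) = (1-x,1-y,z), f3(x,y,z) = (1-x,z,1-y). Let Q be the quotient topological space of [0,1]^3 by ~, let v ∈ Q be the common image of the eight cube vertices, and let X = Q \ {v} with the subspace topology. Then for any basepoint x0 ∈ X, the abelianization of the fundamental group of X at x0 is isomorphic (as a group) to ℤ × (ℤ/2ℤ) × (ℤ/2ℤ). -/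

import Mathlib

/-- The unit cube `[0,1]³` in `ℝ³`. -/
def UnitCube : Set (Fin 3 → ℝ) := {p | ∀ i, 0 ≤ p i ∧ p i ≤ 1}

/-- The diagonal reflection identifying the top face with the bottom face. -/
def g1 : (Fin 3 → ℝ) → (Fin 3 → ℝ) := fun p => ![1 - p 1, 1 - p 0, 1 - p 2]

/-- The horizontal reflection identifying the front face with the back face. -/
def g2 : (Fin 3 → ℝ) → (Fin 3 → ℝ) := fun p => ![1 - p 0, 1 - p 1, p 2]

/-- The quarter-turn rotation identifying the left face with the right face. -/
def g3 : (Fin 3 → ℝ) → (Fin 3 → ℝ) := fun p => ![1 - p 0, p 2, 1 - p 1]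

/-- The top face `[0,1]² × {1}` of the unit cube. -/
def topFace : Set (Fin 3 → ℝ) :=
  {p | 0 ≤ p 0 ∧ p 0 ≤ 1 ∧ 0 ≤ p 1 ∧ p 1 ≤ 1 ∧ p 2 = 1}

/-- The front face `[0,1] × {0} × [0,1]` of the unit cube. -/
def frontFace : Set (Fin 3 → ℝ) :=
  {p | 0 ≤ p 0 ∧ p 0 ≤ 1 ∧ p 1 = 0 ∧ 0 ≤ p 2 ∧ p 2 ≤ 1}

/-- The left face `{0} × [0,1] × [0,1]` of the unit cube. -/
def leftFace : Set (Fin 3 → ℝ) :=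
  {p | p 0 = 0 ∧ 0 ≤ p 1 ∧ p 1 ≤ 1 ∧ 0 ≤ p 2 ∧ p 2 ≤ 1}

/-- The generating relation on the unit cube: `p ~ g1 p` on the top face,
`p ~ g2 p` on the front face, and `p ~ g3 p` on the left face. -/
def faceRel : UnitCube → UnitCube → Prop := fun p q =>
  ((p : Fin 3 → ℝ) ∈ topFace ∧ (q : Fin 3 → ℝ) = g1 p) ∨
  ((p : Fin 3 → ℝ) ∈ frontFace ∧ (q : Fin 3 → ℝ) = g2 p) ∨
  ((p : Fin 3 → ℝ) ∈ leftFace ∧ (q : Fin 3 → ℝ) = g3 p)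

/-- The equivalence relation on the unit cube generated by the face
identifications `g1`, `g2`, `g3`. -/
def cubeSetoid : Setoid UnitCube := Relation.EqvGen.setoid faceRel

/-- The quotient topological space of the unit cube by the face
identifications. -/
abbrev QuotCube : Type := Quotient cubeSetoid

/-- The common image in the quotient of the eight vertices of the cube
(all eight vertices are identified; we take the image of `A = (0,0,1)`). -/
def cuspPoint : QuotCube :=
  Quotient.mk cubeSetoid ⟨![0, 0, 1], by intro i; fin_cases i <;> norm_num⟩

/-- The quotient space with the common image of the eight vertices removed:
the underlying manifold of the census triangulations `x101` and `x103`. -/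
abbrev X : Type := {q : QuotCube // q ≠ cuspPoint}

namespace X101

open Topology Set unitInterval

/-- The cube minus its vertices. -/
def CC : Set (Fin 3 → ℝ) := {p | (∀ i, 0 ≤ p i ∧ p i ≤ 1) ∧ ∃ i, 0 < p i ∧ p i < 1}

lemma convex_CC : Convex ℝ CC := by
  intro p hp q hq a b ha hb hab
  refine ⟨fun i => ?_, ?_⟩
  · have h1 := hp.1 i
    have h2 := hq.1 i
    simp only [Pi.add_apply, Pi.smul_apply, smul_eq_mul]
    constructor
    · have := mul_nonneg ha h1.1
      have := mul_nonneg hb h2.1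
      linarith
    · have := mul_le_mul_of_nonneg_left h1.2 ha
      have := mul_le_mul_of_nonneg_left h2.2 hb
      linarith
  · rcases eq_or_lt_of_le ha with h0 | h0
    · have hb1 : b = 1 := by linarith
      obtain ⟨i, hi⟩ := hq.2
      refine ⟨i, ?_⟩
      simp only [Pi.add_apply, Pi.smul_apply, smul_eq_mul, ← h0, hb1]
      simpa using hi
    · obtain ⟨i, hi⟩ := hp.2
      have h2 := hq.1 i
      refine ⟨i, ?_⟩
      simp only [Pi.add_apply, Pi.smul_apply, smul_eq_mul]
      have := mul_nonneg hb h2.1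
      have := mul_le_mul_of_nonneg_left h2.2 hb
      have := mul_pos h0 hi.1
      have := mul_lt_mul_of_pos_left hi.2 h0
      constructor <;> linarith

/-- The generating relation on the cube minus vertices, with labels. -/
def R (k : Fin 3) (p q : CC) : Prop :=
  (k = 0 ∧ p.1 2 = 1 ∧ q.1 0 = 1 - p.1 1 ∧ q.1 1 = 1 - p.1 0 ∧ q.1 2 = 0) ∨
  (k = 1 ∧ p.1 1 = 0 ∧ q.1 0 = 1 - p.1 0 ∧ q.1 1 = 1 ∧ q.1 2 = p.1 2) ∨
  (k = 2 ∧ p.1 0 = 0 ∧ q.1 0 = 1 ∧ q.1 1 = p.1 2 ∧ q.1 2 = 1 - p.1 1)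

/-- A point of the cube is not a vertex. -/
def NV (p : Fin 3 → ℝ) : Prop := ∃ i, 0 < p i ∧ p i < 1

lemma NV_iff (p : Fin 3 → ℝ) :
    NV p ↔ (0 < p 0 ∧ p 0 < 1) ∨ (0 < p 1 ∧ p 1 < 1) ∨ (0 < p 2 ∧ p 2 < 1) := by
  unfold NV
  constructor
  · rintro ⟨i, hi⟩
    fin_cases i
    · exact Or.inl hi
    · exact Or.inr (Or.inl hi)
    · exact Or.inr (Or.inr hi)
  · rintro (h | h | h)
    exacts [⟨0, h⟩, ⟨1, h⟩, ⟨2, h⟩]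

lemma faceRel_iff (p q : UnitCube) : faceRel p q ↔
    (p.1 2 = 1 ∧ q.1 0 = 1 - p.1 1 ∧ q.1 1 = 1 - p.1 0 ∧ q.1 2 = 0) ∨
    (p.1 1 = 0 ∧ q.1 0 = 1 - p.1 0 ∧ q.1 1 = 1 ∧ q.1 2 = p.1 2) ∨
    (p.1 0 = 0 ∧ q.1 0 = 1 ∧ q.1 1 = p.1 2 ∧ q.1 2 = 1 - p.1 1) := by
  have h0 := p.2 0
  have h1 := p.2 1
  have h2 := p.2 2
  have key : ∀ a b c : ℝ, q.1 = ![a, b, c] ↔ (q.1 0 = a ∧ q.1 1 = b ∧ q.1 2 = c) := by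
    intro a b c
    constructor
    · intro h
      rw [h]
      simp
    · rintro ⟨ha, hb, hc⟩
      ext i
      fin_cases i
      exacts [ha, hb, hc]
  unfold faceRel topFace frontFace leftFace g1 g2 g3
  rw [key, key, key]
  simp only [Set.mem_ofPred_eq]
  constructor
  · rintro (⟨⟨-, -, -, -, h⟩, h'⟩ | ⟨⟨-, -, h, -⟩, h'⟩ | ⟨⟨h, -⟩, h'⟩)
    · rw [h] at h'
      exact Or.inl ⟨h, h'.1, h'.2.1, by simpa using h'.2.2⟩
    · rw [h] at h'
      exact Or.inr (Or.inl ⟨h, h'.1, by simpa using h'.2.1, h'.2.2⟩)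
    · rw [h] at h'
      exact Or.inr (Or.inr ⟨h, by simpa using h'.1, h'.2⟩)
  · rintro (⟨h, a, b, c⟩ | ⟨h, a, b, c⟩ | ⟨h, a, b, c⟩)
    · exact Or.inl ⟨⟨h0.1, h0.2, h1.1, h1.2, h⟩, a, b, by rw [c, h]; simp⟩
    · exact Or.inr (Or.inl ⟨⟨h0.1, h0.2, h, h2.1, h2.2⟩, a, by rw [b, h]; simp, c⟩)
    · exact Or.inr (Or.inr ⟨⟨h, h1.1, h1.2, h2.1, h2.2⟩, by rw [a, h]; simp, b, c⟩)

lemma faceRel_NV {p q : UnitCube} (h : faceRel p q) : NV p.1 ↔ NV q.1 := by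
  rw [NV_iff, NV_iff]
  rw [faceRel_iff] at h
  rcases h with (⟨h, a, b, c⟩ | ⟨h, a, b, c⟩ | ⟨h, a, b, c⟩) <;> rw [h, a, b, c]
  · norm_num
    tauto
  · norm_num
    tauto
  · norm_num
    tauto

lemma eqv_NV {p q : UnitCube} (h : Relation.EqvGen faceRel p q) : NV p.1 ↔ NV q.1 := by
  induction h with
  | rel _ _ h => exact faceRel_NV h
  | refl => exact Iff.rfl
  | symm _ _ _ ih => exact ih.symm
  | trans _ _ _ _ _ ih1 ih2 => exact ih1.trans ih2

/-- The vertex `A`. -/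
def vA : UnitCube := ⟨![0, 0, 1], by intro i; fin_cases i <;> norm_num⟩

lemma cusp_eq : cuspPoint = Quotient.mk cubeSetoid vA := rfl

lemma mk_eq_iff (p q : UnitCube) :
    Quotient.mk cubeSetoid p = Quotient.mk cubeSetoid q ↔ Relation.EqvGen faceRel p q := by
  rw [Quotient.eq]; rfl

lemma mk_faceRel {p q : UnitCube} (h : faceRel p q) :
    Quotient.mk cubeSetoid p = Quotient.mk cubeSetoid q := by
  rw [mk_eq_iff]; exact .rel _ _ h

/-- A vertex of the cube. -/
def vtx (a b c : Bool) : UnitCube :=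
  ⟨![if a then 1 else 0, if b then 1 else 0, if c then 1 else 0], by
    intro i; fin_cases i <;> simp <;> split <;> norm_num⟩

lemma vtx_all (a b c : Bool) : Quotient.mk cubeSetoid (vtx a b c) = cuspPoint := by
  have hA : cuspPoint = Quotient.mk cubeSetoid (vtx false false true) := by
    rw [cusp_eq]
    congr 1
  have f1 : ∀ x y, Quotient.mk cubeSetoid (vtx x y true) =
      Quotient.mk cubeSetoid (vtx (!y) (!x) false) := by
    intro x y
    apply mk_faceRel
    rw [faceRel_iff]
    left
    cases x <;> cases y <;> simp [vtx]
  have f2 : ∀ x z, Quotient.mk cubeSetoid (vtx x false z) =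
      Quotient.mk cubeSetoid (vtx (!x) true z) := by
    intro x y
    apply mk_faceRel
    rw [faceRel_iff]
    right; left
    cases x <;> cases y <;> simp [vtx]
  have f3 : ∀ y z, Quotient.mk cubeSetoid (vtx false y z) =
      Quotient.mk cubeSetoid (vtx true z (!y)) := by
    intro x y
    apply mk_faceRel
    rw [faceRel_iff]
    right; right
    cases x <;> cases y <;> simp [vtx]
  rw [hA]
  have a1 := f1 false false
  have a2 := f1 false true
  have a3 := f1 true false
  have a4 := f1 true true
  have b1 := f2 false false
  have b2 := f2 false true
  have b3 := f2 true false
  have b4 := f2 true true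
  have c1 := f3 false false
  have c2 := f3 false true
  have c3 := f3 true false
  have c4 := f3 true true
  simp only [Bool.not_true, Bool.not_false] at *
  clear f1 f2 f3 hA
  generalize hv : (fun x y z => Quotient.mk cubeSetoid (vtx x y z)) = v at *
  have hv' : ∀ x y z, Quotient.mk cubeSetoid (vtx x y z) = v x y z := by
    intro x y z; rw [← hv]
  simp only [hv'] at *
  cases a <;> cases b <;> cases c <;> grind

lemma mk_ne_cusp_iff (p : UnitCube) : Quotient.mk cubeSetoid p ≠ cuspPoint ↔ NV p.1 := by
  constructor
  · intro h
    by_contra hn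
    apply h
    have hv : ∀ i, p.1 i = 0 ∨ p.1 i = 1 := by
      intro i
      by_contra! hi
      exact hn ⟨i, lt_of_le_of_ne (p.2 i).1 hi.1.symm, lt_of_le_of_ne (p.2 i).2 hi.2⟩
    have : p = vtx (decide (p.1 0 = 1)) (decide (p.1 1 = 1)) (decide (p.1 2 = 1)) := by
      apply Subtype.ext
      ext i
      have := hv i
      fin_cases i <;> simp [vtx] <;> simp at this <;> split <;> simp_all
    rw [this]
    exact vtx_all _ _ _
  · intro h e
    rw [cusp_eq, mk_eq_iff] at e
    rw [eqv_NV e, NV_iff] at h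
    simp [vA] at h

/-- The projection. -/
def pr (p : CC) : X := ⟨Quotient.mk cubeSetoid ⟨p.1, p.2.1⟩, (mk_ne_cusp_iff _).2 p.2.2⟩

lemma R_faceRel {k : Fin 3} {p q : CC} (h : R k p q) :
    faceRel ⟨p.1, p.2.1⟩ ⟨q.1, q.2.1⟩ := by
  rw [faceRel_iff]
  rcases h with h | h | h
  · exact Or.inl h.2
  · exact Or.inr (Or.inl h.2)
  · exact Or.inr (Or.inr h.2)

lemma faceRel_R {p q : CC} (h : faceRel ⟨p.1, p.2.1⟩ ⟨q.1, q.2.1⟩) : ∃ k, R k p q := by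
  rw [faceRel_iff] at h
  rcases h with h | h | h
  · exact ⟨0, Or.inl ⟨rfl, h⟩⟩
  · exact ⟨1, Or.inr (Or.inl ⟨rfl, h⟩)⟩
  · exact ⟨2, Or.inr (Or.inr ⟨rfl, h⟩)⟩

lemma pr_R {k : Fin 3} {p q : CC} (h : R k p q) : pr p = pr q :=
  Subtype.ext (mk_faceRel (R_faceRel h))

/-- Induction principle for equality in the quotient. -/
lemma pr_ind {P : CC → CC → Prop} (hR : ∀ k p q, R k p q → P p q) (hrefl : ∀ p, P p p)
    (hsymm : ∀ p q, P p q → P q p) (htrans : ∀ p q r, pr p = pr q → pr q = pr r →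
      P p q → P q r → P p r)
    {p q : CC} (h : pr p = pr q) : P p q := by
  have h1 : Relation.EqvGen faceRel ⟨p.1, p.2.1⟩ ⟨q.1, q.2.1⟩ :=
    (mk_eq_iff _ _).1 (congrArg Subtype.val h)
  have key : ∀ a b : UnitCube, Relation.EqvGen faceRel a b → ∀ (ha : NV a.1) (hb : NV b.1),
      P ⟨a.1, a.2, ha⟩ ⟨b.1, b.2, hb⟩ := by
    intro a b hab
    induction hab with
    | rel a b h =>
      intro ha hb
      obtain ⟨k, hk⟩ := faceRel_R (p := ⟨a.1, a.2, ha⟩) (q := ⟨b.1, b.2, hb⟩) h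
      exact hR k _ _ hk
    | refl => intro _ _; exact hrefl _
    | symm _ _ _ ih => intro ha hb; exact hsymm _ _ (ih hb ha)
    | trans a b c h1 h2 ih1 ih2 =>
      intro ha hc
      have hb := (eqv_NV h1).1 ha
      refine htrans _ ⟨b.1, b.2, hb⟩ _ ?_ ?_ (ih1 ha hb) (ih2 hb hc)
      · exact Subtype.ext ((mk_eq_iff _ _).2 h1)
      · exact Subtype.ext ((mk_eq_iff _ _).2 h2)
  exact key _ _ h1 p.2.2 q.2.2

lemma isOpen_ne_cusp : IsOpen {q : QuotCube | q ≠ cuspPoint} := by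
  have h0 : IsQuotientMap (Quotient.mk cubeSetoid) := isQuotientMap_quotient_mk'
  rw [← h0.isOpen_preimage]
  have : (Quotient.mk cubeSetoid ⁻¹' {q : QuotCube | q ≠ cuspPoint} : Set UnitCube) =
      ⋃ i, {p : UnitCube | 0 < p.1 i ∧ p.1 i < 1} := by
    ext p
    have := mk_ne_cusp_iff p
    simp only [mem_preimage, mem_ofPred_eq, mem_iUnion]
    exact this
  rw [this]
  refine isOpen_iUnion fun i => ?_
  have hc : Continuous fun p : UnitCube => p.1 i :=
    (continuous_apply i).comp continuous_subtype_val
  exact (isOpen_lt continuous_const hc).inter (isOpen_lt hc continuous_const)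

lemma isQuotientMap_pr : IsQuotientMap pr := by
  have h0 : IsQuotientMap (Quotient.mk cubeSetoid) := isQuotientMap_quotient_mk'
  have h := h0.restrictPreimage_isOpen isOpen_ne_cusp
  let e : CC ≃ₜ (Quotient.mk cubeSetoid ⁻¹' {q : QuotCube | q ≠ cuspPoint}) :=
    { toFun := fun p => ⟨⟨p.1, p.2.1⟩, (mk_ne_cusp_iff _).2 p.2.2⟩
      invFun := fun p => ⟨p.1.1, p.1.2, (mk_ne_cusp_iff _).1 p.2⟩
      left_inv := fun p => rfl
      right_inv := fun p => rfl
      continuous_toFun := by fun_prop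
      continuous_invFun := by fun_prop }
  exact h.comp e.isQuotientMap

lemma continuous_pr : Continuous pr := isQuotientMap_pr.continuous


/-- Straight line between two points. -/
noncomputable def lin (p q : CC) (t : I) : CC :=
  ⟨fun i => (1 - (t : ℝ)) * p.1 i + t * q.1 i, by
    have := convex_CC p.2 q.2 (sub_nonneg.2 t.2.2) t.2.1 (by ring)
    exact this⟩

lemma lin_apply (p q : CC) (t : I) (i : Fin 3) :
    (lin p q t).1 i = (1 - (t : ℝ)) * p.1 i + t * q.1 i := rfl

@[simp] lemma lin_zero (p q : CC) : lin p q 0 = p := by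
  apply Subtype.ext
  ext i
  simp [lin_apply]

@[simp] lemma lin_one (p q : CC) : lin p q 1 = q := by
  apply Subtype.ext
  ext i
  simp [lin_apply]

lemma continuous_coord (i : Fin 3) : Continuous fun p : CC => p.1 i :=
  (continuous_apply i).comp continuous_subtype_val

lemma continuous_lin3 : Continuous fun x : (CC × CC) × I => lin x.1.1 x.1.2 x.2 := by
  refine Continuous.subtype_mk (continuous_pi fun i => ?_) _
  have h1 : Continuous fun x : (CC × CC) × I => x.1.1.1 i :=
    (continuous_coord i).comp (continuous_fst.comp continuous_fst)
  have h2 : Continuous fun x : (CC × CC) × I => x.1.2.1 i :=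
    (continuous_coord i).comp (continuous_snd.comp continuous_fst)
  have h3 : Continuous fun x : (CC × CC) × I => (x.2 : ℝ) :=
    continuous_subtype_val.comp continuous_snd
  exact ((continuous_const.sub h3).mul h1).add (h3.mul h2)

/-- The straight path. -/
noncomputable def linPath (p q : CC) : Path p q where
  toFun := lin p q
  continuous_toFun := continuous_lin3.comp
    (continuous_const.prodMk continuous_id : Continuous fun t : I => ((p, q), t))
  source' := lin_zero p q
  target' := lin_one p q

lemma R_lin {k : Fin 3} {p q p' q' : CC} (h : R k p q) (h' : R k p' q') (t : I) :
    R k (lin p p' t) (lin q q' t) := by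
  unfold R at *
  simp only [lin_apply]
  rcases h with ⟨rfl, h1, h2, h3, h4⟩ | ⟨rfl, h1, h2, h3, h4⟩ | ⟨rfl, h1, h2, h3, h4⟩ <;>
  rcases h' with ⟨hk, k1, k2, k3, k4⟩ | ⟨hk, k1, k2, k3, k4⟩ | ⟨hk, k1, k2, k3, k4⟩ <;>
  simp at hk
  · left
    rw [h1, h2, h3, h4, k1, k2, k3, k4]
    refine ⟨rfl, ?_, ?_, ?_, ?_⟩ <;> ring
  · right; left
    rw [h1, h2, h3, h4, k1, k2, k3, k4]
    refine ⟨rfl, ?_, ?_, ?_, ?_⟩ <;> ring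
  · right; right
    rw [h1, h2, h3, h4, k1, k2, k3, k4]
    refine ⟨rfl, ?_, ?_, ?_, ?_⟩ <;> ring

/-- A separated set of coordinates. -/
structure Nice (ε : ℝ) (S : Set ℝ) : Prop where
  pos : 0 < ε
  zero : (0 : ℝ) ∈ S
  one : (1 : ℝ) ∈ S
  refl : ∀ s ∈ S, 1 - s ∈ S
  sep : ∀ s ∈ S, ∀ s' ∈ S, |s - s'| < 2 * ε → s = s'

lemma exists_nice (p : CC) : ∃ ε S, Nice ε S ∧ ∀ i, p.1 i ∈ S := by
  let S : Set ℝ := {0, 1} ∪ (range p.1 ∪ (fun s => 1 - s) '' range p.1)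
  have hfin : S.Finite :=
    (Set.toFinite _).union ((Set.finite_range _).union ((Set.finite_range _).image _))
  have hne : ∃ ε > 0, ∀ s ∈ S, ∀ s' ∈ S, |s - s'| < 2 * ε → s = s' := by
    have hD : ((fun x : ℝ × ℝ => |x.1 - x.2|) '' (S ×ˢ S) \ {0}).Finite :=
      ((hfin.prod hfin).image _).subset sdiff_subset
    obtain ⟨δ, hδ, hδ'⟩ : ∃ δ > 0, ∀ d ∈ ((fun x : ℝ × ℝ => |x.1 - x.2|) '' (S ×ˢ S) \ {0}),
        δ ≤ d := by
      rcases ((fun x : ℝ × ℝ => |x.1 - x.2|) '' (S ×ˢ S) \ {0}).eq_empty_or_nonempty with h | h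
      · rw [h]
        exact ⟨1, one_pos, by simp⟩
      · obtain ⟨m, hm, hm'⟩ := Set.exists_min_image _ id hD h
        refine ⟨m, ?_, hm'⟩
        obtain ⟨⟨x, -, rfl⟩, h0⟩ := hm
        exact lt_of_le_of_ne (abs_nonneg _) (Ne.symm h0)
    refine ⟨δ / 2, by positivity, fun s hs s' hs' h => ?_⟩
    by_contra hne
    have := hδ' |s - s'| ⟨⟨(s, s'), ⟨hs, hs'⟩, rfl⟩, by
      simpa [sub_eq_zero] using hne⟩
    linarith
  obtain ⟨ε, hε, hsep⟩ := hne
  refine ⟨ε, S, ⟨hε, by simp [S], by simp [S], ?_, hsep⟩, fun i => Or.inr (Or.inl ⟨i, rfl⟩)⟩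
  rintro s ((rfl | rfl) | ⟨i, rfl⟩ | ⟨_, ⟨i, rfl⟩, rfl⟩)
  · simp [S]
  · simp [S]
  · exact Or.inr (Or.inr ⟨_, ⟨i, rfl⟩, rfl⟩)
  · right; left
    exact ⟨i, by simp⟩

/-- Closeness. -/
def near (ε : ℝ) (p q : CC) : Prop := ∀ i, |p.1 i - q.1 i| < ε

/-- All coordinates lie in `S`. -/
def CS (S : Set ℝ) (p : CC) : Prop := ∀ i, p.1 i ∈ S

lemma near_unique {ε S} (hn : Nice ε S) {p q r : CC} (hq : CS S q) (hr : CS S r)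
    (h1 : near ε p q) (h2 : near ε p r) : q = r := by
  apply Subtype.ext
  ext i
  apply hn.sep _ (hq i) _ (hr i)
  have a := abs_lt.1 (h1 i)
  have b := abs_lt.1 (h2 i)
  rw [abs_lt]
  constructor <;> linarith

lemma near_self {ε S} (hn : Nice ε S) (p : CC) : near ε p p := by
  intro i
  simpa using hn.pos

lemma isOpen_near (ε : ℝ) (q : CC) : IsOpen {p : CC | near ε p q} := by
  have : {p : CC | near ε p q} = ⋂ i, {p : CC | |p.1 i - q.1 i| < ε} := by
    ext p
    simp [near]
  rw [this]
  refine isOpen_iInter_of_finite fun i => ?_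
  exact isOpen_lt ((continuous_coord i).sub continuous_const).abs continuous_const

/-- Building a point. -/
lemma exists_pt {a b c : ℝ} (ha : 0 ≤ a ∧ a ≤ 1) (hb : 0 ≤ b ∧ b ≤ 1) (hc : 0 ≤ c ∧ c ≤ 1)
    (h : (0 < a ∧ a < 1) ∨ (0 < b ∧ b < 1) ∨ (0 < c ∧ c < 1)) :
    ∃ r : CC, r.1 0 = a ∧ r.1 1 = b ∧ r.1 2 = c := by
  refine ⟨⟨![a, b, c], ?_, ?_⟩, rfl, rfl, rfl⟩
  · intro i
    fin_cases i
    exacts [ha, hb, hc]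
  · exact (NV_iff _).2 h

lemma forall3 {P : Fin 3 → Prop} : (∀ i, P i) ↔ P 0 ∧ P 1 ∧ P 2 := Fin.forall_fin_succ.trans
  (and_congr Iff.rfl (Fin.forall_fin_succ.trans (and_congr Iff.rfl (by simp))))

lemma step_fwd {ε S} (hn : Nice ε S) {k : Fin 3} {p' p'' p : CC} (h : R k p' p'')
    (hp : CS S p) (hnear : near ε p' p) : ∃ r, CS S r ∧ near ε p'' r ∧ R k p r := by
  have hb0 := p.2.1 0
  have hb1 := p.2.1 1
  have hb2 := p.2.1 2
  have hv := (NV_iff _).1 p.2.2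
  unfold CS near at *
  simp only [forall3] at *
  have hε := hn.pos
  obtain ⟨s0, s1, s2⟩ := hp
  obtain ⟨n0, n1, n2⟩ := hnear
  have key : ∀ a b : ℝ, a ∈ S → b ∈ S → |b - a| < ε → a = b := by
    intro a b ha hb h
    apply hn.sep a ha b hb
    rw [abs_sub_comm]
    linarith
  rcases h with ⟨rfl, h1, h2, h3, h4⟩ | ⟨rfl, h1, h2, h3, h4⟩ | ⟨rfl, h1, h2, h3, h4⟩
  · rw [h1] at n2
    have e := key _ _ s2 hn.one n2
    obtain ⟨r, r0, r1, r2⟩ := exists_pt (a := 1 - p.1 1) (b := 1 - p.1 0) (c := 0)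
      ⟨by linarith, by linarith⟩ ⟨by linarith, by linarith⟩ ⟨by linarith, by linarith⟩ (by
        rw [e] at hv; grind)
    refine ⟨r, ?_, ?_, Or.inl ⟨rfl, e, r0, r1, r2⟩⟩
    · rw [r0, r1, r2]
      exact ⟨hn.refl _ s1, hn.refl _ s0, hn.zero⟩
    · rw [r0, r1, r2, h2, h3, h4]
      simp only [abs_lt] at *
      refine ⟨⟨?_, ?_⟩, ⟨?_, ?_⟩, ⟨?_, ?_⟩⟩ <;> linarith
  · rw [h1] at n1
    have e := key _ _ s1 hn.zero n1
    obtain ⟨r, r0, r1, r2⟩ := exists_pt (a := 1 - p.1 0) (b := 1) (c := p.1 2)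
      ⟨by linarith, by linarith⟩ ⟨by linarith, by linarith⟩ ⟨by linarith, by linarith⟩ (by
        rw [e] at hv; grind)
    refine ⟨r, ?_, ?_, Or.inr (Or.inl ⟨rfl, e, r0, r1, r2⟩)⟩
    · rw [r0, r1, r2]
      exact ⟨hn.refl _ s0, hn.one, s2⟩
    · rw [r0, r1, r2, h2, h3, h4]
      simp only [abs_lt] at *
      refine ⟨⟨?_, ?_⟩, ⟨?_, ?_⟩, ⟨?_, ?_⟩⟩ <;> linarith
  · rw [h1] at n0
    have e := key _ _ s0 hn.zero n0
    obtain ⟨r, r0, r1, r2⟩ := exists_pt (a := 1) (b := p.1 2) (c := 1 - p.1 1)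
      ⟨by linarith, by linarith⟩ ⟨by linarith, by linarith⟩ ⟨by linarith, by linarith⟩ (by
        rw [e] at hv; grind)
    refine ⟨r, ?_, ?_, Or.inr (Or.inr ⟨rfl, e, r0, r1, r2⟩)⟩
    · rw [r0, r1, r2]
      exact ⟨hn.one, s2, hn.refl _ s1⟩
    · rw [r0, r1, r2, h2, h3, h4]
      simp only [abs_lt] at *
      refine ⟨⟨?_, ?_⟩, ⟨?_, ?_⟩, ⟨?_, ?_⟩⟩ <;> linarith

lemma step_bwd {ε S} (hn : Nice ε S) {k : Fin 3} {p' p'' p : CC} (h : R k p'' p')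
    (hp : CS S p) (hnear : near ε p' p) : ∃ r, CS S r ∧ near ε p'' r ∧ R k r p := by
  have hb0 := p.2.1 0
  have hb1 := p.2.1 1
  have hb2 := p.2.1 2
  have hv := (NV_iff _).1 p.2.2
  unfold CS near at *
  simp only [forall3] at *
  have hε := hn.pos
  obtain ⟨s0, s1, s2⟩ := hp
  obtain ⟨n0, n1, n2⟩ := hnear
  have key : ∀ a b : ℝ, a ∈ S → b ∈ S → |b - a| < ε → a = b := by
    intro a b ha hb h
    apply hn.sep a ha b hb
    rw [abs_sub_comm]
    linarith
  rcases h with ⟨rfl, h1, h2, h3, h4⟩ | ⟨rfl, h1, h2, h3, h4⟩ | ⟨rfl, h1, h2, h3, h4⟩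
  · rw [h4] at n2
    have e := key _ _ s2 hn.zero n2
    obtain ⟨r, r0, r1, r2⟩ := exists_pt (a := 1 - p.1 1) (b := 1 - p.1 0) (c := 1)
      ⟨by linarith, by linarith⟩ ⟨by linarith, by linarith⟩ ⟨by linarith, by linarith⟩ (by
        rw [e] at hv; grind)
    refine ⟨r, ?_, ?_, Or.inl ⟨rfl, r2, by rw [r1]; ring, by rw [r0]; ring, e⟩⟩
    · rw [r0, r1, r2]
      exact ⟨hn.refl _ s1, hn.refl _ s0, hn.one⟩
    · rw [r0, r1, r2, h1]
      simp only [abs_lt] at *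
      refine ⟨⟨?_, ?_⟩, ⟨?_, ?_⟩, ⟨?_, ?_⟩⟩ <;> linarith
  · rw [h3] at n1
    have e := key _ _ s1 hn.one n1
    obtain ⟨r, r0, r1, r2⟩ := exists_pt (a := 1 - p.1 0) (b := 0) (c := p.1 2)
      ⟨by linarith, by linarith⟩ ⟨by linarith, by linarith⟩ ⟨by linarith, by linarith⟩ (by
        rw [e] at hv; grind)
    refine ⟨r, ?_, ?_, Or.inr (Or.inl ⟨rfl, r1, by rw [r0]; ring, e, by rw [r2]⟩)⟩
    · rw [r0, r1, r2]
      exact ⟨hn.refl _ s0, hn.zero, s2⟩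
    · rw [r0, r1, r2, h1]
      simp only [abs_lt] at *
      refine ⟨⟨?_, ?_⟩, ⟨?_, ?_⟩, ⟨?_, ?_⟩⟩ <;> linarith
  · rw [h2] at n0
    have e := key _ _ s0 hn.one n0
    obtain ⟨r, r0, r1, r2⟩ := exists_pt (a := 0) (b := 1 - p.1 2) (c := p.1 1)
      ⟨by linarith, by linarith⟩ ⟨by linarith, by linarith⟩ ⟨by linarith, by linarith⟩ (by
        rw [e] at hv; grind)
    refine ⟨r, ?_, ?_, Or.inr (Or.inr ⟨rfl, r0, e, by rw [r2], by rw [r1]; ring⟩)⟩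
    · rw [r0, r1, r2]
      exact ⟨hn.zero, hn.refl _ s2, s1⟩
    · rw [r0, r1, r2, h1]
      simp only [abs_lt] at *
      refine ⟨⟨?_, ?_⟩, ⟨?_, ?_⟩, ⟨?_, ?_⟩⟩ <;> linarith

lemma CS_of_pr_eq {ε S} (hn : Nice ε S) {p q : CC} (h : pr p = pr q) : CS S p ↔ CS S q := by
  refine pr_ind (P := fun p q => CS S p ↔ CS S q) ?_ (fun _ => Iff.rfl)
    (fun _ _ h => h.symm) (fun _ _ _ _ _ h1 h2 => h1.trans h2) h
  intro k p q h
  constructor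
  · intro hp
    obtain ⟨r, hr, -, hk⟩ := step_fwd hn h hp (near_self hn p)
    have : r = q := by
      apply Subtype.ext
      ext i
      revert i
      rw [forall3]
      rcases h with ⟨rfl, h⟩ | ⟨rfl, h⟩ | ⟨rfl, h⟩ <;>
      rcases hk with ⟨h0, h'⟩ | ⟨h0, h'⟩ | ⟨h0, h'⟩ <;> simp at h0 <;> grind
    exact this ▸ hr
  · intro hp
    obtain ⟨r, hr, -, hk⟩ := step_bwd hn h hp (near_self hn q)
    have : r = p := by
      apply Subtype.ext
      ext i
      revert i
      rw [forall3]
      rcases h with ⟨rfl, h⟩ | ⟨rfl, h⟩ | ⟨rfl, h⟩ <;>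
      rcases hk with ⟨h0, h'⟩ | ⟨h0, h'⟩ | ⟨h0, h'⟩ <;> simp at h0 <;> grind
    exact this ▸ hr

/-- Local structure near a point. `φ` is a potential. -/
lemma local_step {G : Type*} [CommGroup G] {φ : CC → G} {w : Fin 3 → G}
    (hφ : ∀ k p q, R k p q → φ q = φ p * w k)
    {ε S} (hn : Nice ε S) {p' p'' : CC} (h : pr p' = pr p'') :
    ∀ p, CS S p → near ε p' p → ∃ r, CS S r ∧ near ε p'' r ∧ pr p = pr r ∧
      φ r * φ p' = φ p * φ p'' ∧ ∀ t, pr (lin p' p t) = pr (lin p'' r t) := by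
  let Q : CC → CC → Prop := fun p' p'' => ∀ p, CS S p → near ε p' p → ∃ r, CS S r ∧
      near ε p'' r ∧ pr p = pr r ∧
      φ r * φ p' = φ p * φ p'' ∧ ∀ t, pr (lin p' p t) = pr (lin p'' r t)
  have : Q p' p'' ∧ Q p'' p' := by
    refine pr_ind (P := fun p q => Q p q ∧ Q q p) ?_ ?_ (fun _ _ h => h.symm) ?_ h
    · intro k p' p'' hk
      constructor
      · intro p hp hnear
        obtain ⟨r, hr, hr', hR⟩ := step_fwd hn hk hp hnear
        refine ⟨r, hr, hr', pr_R hR, ?_, fun t => pr_R (R_lin hk hR t)⟩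
        rw [hφ _ _ _ hR, hφ _ _ _ hk]
        simp only [mul_comm, mul_left_comm]
      · intro p hp hnear
        obtain ⟨r, hr, hr', hR⟩ := step_bwd hn hk hp hnear
        refine ⟨r, hr, hr', (pr_R hR).symm, ?_, fun t => (pr_R (R_lin hk hR t)).symm⟩
        rw [hφ _ _ _ hR, hφ _ _ _ hk]
        simp only [mul_comm, mul_left_comm]
    · intro p
      have : Q p p := fun r hr hn => ⟨r, hr, hn, rfl, rfl, fun _ => rfl⟩
      exact ⟨this, this⟩
    · have : ∀ a b c, Q a b → Q b c → Q a c := by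
        intro a b c h1 h2 p hp hnear
        obtain ⟨r, hr, hr', e, f, g⟩ := h1 p hp hnear
        obtain ⟨s, hs, hs', e', f', g'⟩ := h2 r hr hr'
        refine ⟨s, hs, hs', e.trans e', ?_, fun t => (g t).trans (g' t)⟩
        have : (φ s * φ b) * (φ r * φ a) = (φ r * φ c) * (φ p * φ b) := by rw [f, f']
        have h3 : (φ r * φ b) * (φ s * φ a) = (φ r * φ b) * (φ p * φ c) := by
          calc _ = (φ s * φ b) * (φ r * φ a) := by
                simp only [mul_comm, mul_left_comm]
            _ = _ := this
            _ = _ := by simp only [mul_comm, mul_left_comm]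
        exact mul_left_cancel h3
      intro a b c _ _ h1 h2
      exact ⟨this _ _ _ h1.1 h2.1, this _ _ _ h2.2 h1.2⟩
  exact this.1


/-- The star neighborhood of `x`. -/
def star (ε : ℝ) (x : X) : Set X := {y | ∃ p' p, pr p' = y ∧ pr p = x ∧ near ε p' p}

/-- Local structure without potential. -/
lemma local_step' {ε S} (hn : Nice ε S) {p' p'' : CC} (h : pr p' = pr p'') :
    ∀ p, CS S p → near ε p' p → ∃ r, CS S r ∧ near ε p'' r ∧ pr p = pr r ∧
      ∀ t, pr (lin p' p t) = pr (lin p'' r t) := by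
  intro p hp hnear
  obtain ⟨r, h1, h2, h3, -, h4⟩ := local_step (G := Multiplicative ℤ) (φ := fun _ => 1)
    (w := fun _ => 1) (fun _ _ _ _ => by simp) hn h p hp hnear
  exact ⟨r, h1, h2, h3, h4⟩

lemma mem_star_iff {ε S} (hn : Nice ε S) {p0 : CC} (h0 : CS S p0) (p' : CC) :
    pr p' ∈ star ε (pr p0) ↔ ∃ p, pr p = pr p0 ∧ near ε p' p := by
  constructor
  · rintro ⟨q', q, h1, h2, h3⟩
    obtain ⟨r, -, hr2, hr3, -⟩ := local_step' hn h1 q ((CS_of_pr_eq hn h2).2 h0) h3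
    exact ⟨r, hr3.symm.trans h2, hr2⟩
  · rintro ⟨p, h1, h2⟩
    exact ⟨p', p, rfl, h1, h2⟩

lemma isOpen_star {ε S} (hn : Nice ε S) {p0 : CC} (h0 : CS S p0) :
    IsOpen (star ε (pr p0)) := by
  rw [← isQuotientMap_pr.isOpen_preimage]
  have : pr ⁻¹' star ε (pr p0) = ⋃ p ∈ {p | pr p = pr p0}, {p' | near ε p' p} := by
    ext p'
    rw [mem_preimage, mem_star_iff hn h0]
    simp
  rw [this]
  exact isOpen_biUnion fun p _ => isOpen_near ε p

lemma near_lin {ε S} (hn : Nice ε S) {p' p : CC} (h : near ε p' p) (t : I) :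
    near ε (lin p' p t) p := by
  intro i
  rw [lin_apply]
  have e : (1 - (t : ℝ)) * p'.1 i + t * p.1 i - p.1 i = (1 - (t : ℝ)) * (p'.1 i - p.1 i) := by
    ring
  rw [e, abs_mul, abs_of_nonneg (sub_nonneg.2 t.2.2)]
  have h1 := h i
  have h2 : (1 - (t : ℝ)) ≤ 1 := by linarith [t.2.1]
  calc _ ≤ 1 * |p'.1 i - p.1 i| := mul_le_mul_of_nonneg_right h2 (abs_nonneg _)
    _ < ε := by rw [one_mul]; exact h1

lemma simplyConnected_star {ε S} (hn : Nice ε S) {p0 : CC} (h0 : CS S p0) :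
    SimplyConnectedSpace (star ε (pr p0)) := by
  classical
  set U := star ε (pr p0) with hU
  have hq : IsQuotientMap (U.restrictPreimage pr) :=
    isQuotientMap_pr.restrictPreimage_isOpen (isOpen_star hn h0)
  have hex : ∀ v : pr ⁻¹' U, ∃ p, pr p = pr p0 ∧ near ε v.1 p :=
    fun v => (mem_star_iff hn h0 v.1).1 v.2
  choose c hc1 hc2 using hex
  have hcS : ∀ v, CS S (c v) := fun v => (CS_of_pr_eq hn (hc1 v)).2 h0
  have hcont : Continuous c := by
    refine IsLocallyConstant.continuous ?_
    rw [IsLocallyConstant.iff_exists_open]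
    intro v
    refine ⟨{v' | near ε v'.1 (c v)}, (isOpen_near ε (c v)).preimage continuous_subtype_val,
      hc2 v, ?_⟩
    intro v' hv'
    exact near_unique hn (hcS v') (hcS v) (hc2 v') hv'
  let h : (pr ⁻¹' U) × I → U := fun x => ⟨pr (lin x.1.1 (c x.1) x.2),
    (mem_star_iff hn h0 _).2 ⟨c x.1, hc1 _, near_lin hn (hc2 _) _⟩⟩
  have hh : Continuous h := by
    refine Continuous.subtype_mk (continuous_pr.comp ?_) _
    exact continuous_lin3.comp
      (((continuous_subtype_val.comp continuous_fst).prodMk (hcont.comp continuous_fst)).prodMk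
        continuous_snd)
  have hwd : ∀ v v' : pr ⁻¹' U, pr v.1 = pr v'.1 → ∀ t, h (v, t) = h (v', t) := by
    intro v v' e t
    apply Subtype.ext
    obtain ⟨r, hr1, hr2, hr3, hr4⟩ := local_step' hn e (c v) (hcS v) (hc2 v)
    have : r = c v' := near_unique hn hr1 (hcS v') hr2 (hc2 v')
    rw [this] at hr4
    exact hr4 t
  let s : U → pr ⁻¹' U := Function.surjInv hq.surjective
  have hs : ∀ u, U.restrictPreimage pr (s u) = u := Function.surjInv_eq hq.surjective
  let H : U × I → U := fun x => h (s x.1, x.2)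
  have hHh : ∀ v t, H (U.restrictPreimage pr v, t) = h (v, t) := by
    intro v t
    apply hwd
    exact congrArg Subtype.val (hs (U.restrictPreimage pr v))
  have hH : Continuous H := by
    refine hq.continuous_lift_prod_left ?_
    simp only [hHh]
    exact hh
  have : ContractibleSpace U := by
    rw [contractible_iff_id_nullhomotopic]
    refine ⟨⟨pr p0, ⟨p0, p0, rfl, rfl, near_self hn p0⟩⟩, ⟨?_⟩⟩
    refine ⟨⟨fun x => H (x.2, x.1), hH.comp continuous_swap⟩, ?_, ?_⟩
    · intro u
      obtain ⟨v, rfl⟩ := hq.surjective u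
      change H (_, 0) = _
      rw [hHh]
      apply Subtype.ext
      simp [h]
    · intro u
      obtain ⟨v, rfl⟩ := hq.surjective u
      change H (_, 1) = _
      rw [hHh]
      apply Subtype.ext
      simp only [h, lin_one]
      exact hc1 v
  infer_instance

instance : ContractibleSpace CC := by
  refine convex_CC.contractibleSpace ⟨fun _ => 1 / 2, fun i => ?_, 0, ?_⟩ <;> norm_num

/-- The covering space. -/
def EE {G : Type} [CommGroup G] (_φ : CC → G) : Type := X × G

section Cover

variable {G : Type} [CommGroup G] (φ : CC → G)

/-- The defining projection to the covering space. -/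
def kap (x : CC × G) : EE φ := (pr x.1, x.2 * (φ x.1)⁻¹)

instance : TopologicalSpace (EE φ) :=
  letI : TopologicalSpace G := ⊥
  TopologicalSpace.coinduced (kap φ) inferInstance

instance : MulAction G (EE φ) where
  smul g e := (e.1, g * e.2)
  one_smul e := Prod.ext rfl (one_mul _)
  mul_smul g h e := Prod.ext rfl (mul_assoc _ _ _)

/-- The covering projection. -/
def cov (e : EE φ) : X := e.1

lemma smul_def' (g : G) (e : EE φ) : g • e = (e.1, g * e.2) := rfl

lemma kap_surjective : Function.Surjective (kap φ) := by
  rintro ⟨x, g⟩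
  obtain ⟨p, rfl⟩ := isQuotientMap_pr.surjective x
  exact ⟨(p, g * φ p), Prod.ext rfl (mul_inv_cancel_right g (φ p))⟩

lemma isQuotientMap_kap : letI : TopologicalSpace G := ⊥; IsQuotientMap (kap φ) := by
  letI : TopologicalSpace G := ⊥
  exact ⟨⟨rfl⟩, kap_surjective φ⟩

lemma smul_kap (g : G) (p : CC) (s : G) : g • kap φ (p, s) = kap φ (p, g * s) := by
  exact Prod.ext rfl (mul_assoc g s (φ p)⁻¹).symm

lemma isQuotientCoveringMap_cov {w : Fin 3 → G}
    (hφ : ∀ k p q, R k p q → φ q = φ p * w k) : IsQuotientCoveringMap (cov φ) G := by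
  letI : TopologicalSpace G := ⊥
  haveI : DiscreteTopology G := ⟨rfl⟩
  have hk : IsQuotientMap (kap φ) := isQuotientMap_kap φ
  have hc : Continuous (cov φ) := by
    rw [hk.continuous_iff]
    exact continuous_pr.comp continuous_fst
  have hfst : IsQuotientMap (Prod.fst : CC × G → CC) :=
    isOpenMap_fst.isQuotientMap continuous_fst Prod.fst_surjective
  have hq : IsQuotientMap (cov φ) := by
    refine IsQuotientMap.of_comp hk.continuous hc ?_
    exact isQuotientMap_pr.comp hfst
  refine { toIsQuotientMap := hq, continuous_const_smul := ?_, apply_eq_iff_mem_orbit := ?_,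
           disjoint := ?_ }
  · intro g
    rw [hk.continuous_iff]
    have : ((fun x => g • x) ∘ kap φ) = kap φ ∘ fun x : CC × G => (x.1, g * x.2) := by
      ext ⟨p, s⟩ : 1
      exact smul_kap φ g p s
    rw [this]
    exact hk.continuous.comp
      (continuous_fst.prodMk (continuous_of_discreteTopology.comp continuous_snd))
  · intro e e'
    constructor
    · intro h
      refine ⟨e.2 * e'.2⁻¹, Prod.ext h.symm ?_⟩
      simp [smul_def']
    · rintro ⟨g, rfl⟩
      rfl
  · rintro ⟨x, h⟩
    obtain ⟨p0, rfl⟩ := isQuotientMap_pr.surjective x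
    obtain ⟨ε, S, hn, h0⟩ := exists_nice p0
    let W : Set (CC × G) := {y | ∃ p, pr p = pr p0 ∧ near ε y.1 p ∧ y.2 = h * φ p}
    have hWo : IsOpen W := by
      have : W = ⋃ p ∈ {p | pr p = pr p0}, {p' | near ε p' p} ×ˢ {h * φ p} := by
        ext y
        simp only [W, mem_ofPred_eq, mem_iUnion, mem_prod, mem_singleton_iff, exists_prop]
      rw [this]
      exact isOpen_biUnion fun p _ => (isOpen_near ε p).prod (isOpen_discrete _)
    have hsat : ∀ y, kap φ y ∈ kap φ '' W → y ∈ W := by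
      rintro ⟨p'', s''⟩ ⟨⟨p', s'⟩, ⟨p, h1, h2, h3⟩, h4⟩
      have e1 : pr p' = pr p'' := congrArg Prod.fst h4
      have e2 : s' * (φ p')⁻¹ = s'' * (φ p'')⁻¹ := congrArg Prod.snd h4
      obtain ⟨r, hr1, hr2, hr3, hr4, -⟩ :=
        local_step hφ hn e1 p ((CS_of_pr_eq hn h1).2 h0) h2
      refine ⟨r, hr3.symm.trans h1, hr2, ?_⟩
      simp only at h3 ⊢
      have e3 : s'' = s' * (φ p')⁻¹ * φ p'' := by rw [e2]; simp
      have e4 : φ r = φ p * φ p'' * (φ p')⁻¹ := by rw [← hr4]; simp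
      rw [e3, e4, h3]
      simp only [mul_assoc, mul_comm, mul_left_comm]
    have hVo : IsOpen (kap φ '' W) := by
      rw [← hk.isOpen_preimage]
      have : kap φ ⁻¹' (kap φ '' W) = W :=
        Subset.antisymm (fun y hy => hsat y hy) (subset_preimage_image _ _)
      rw [this]
      exact hWo
    refine ⟨kap φ '' W, hVo.mem_nhds ?_, ?_⟩
    · refine ⟨(p0, h * φ p0), ⟨p0, rfl, near_self hn p0, rfl⟩, ?_⟩
      exact Prod.ext rfl (mul_inv_cancel_right h (φ p0))
    · rintro g ⟨_, ⟨_, ⟨⟨p', s⟩, hy, rfl⟩, rfl⟩, hV⟩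
      simp only [smul_kap] at hV
      have h2 := hsat _ hV
      obtain ⟨p, h1, h2, h3⟩ := hy
      obtain ⟨q, k1, k2, k3⟩ := hsat _ hV
      have : p = q := near_unique hn ((CS_of_pr_eq hn h1).2 h0) ((CS_of_pr_eq hn k1).2 h0) h2 k2
      subst this
      simp only at h3 k3
      rw [← h3] at k3
      exact mul_eq_right.1 k3

end Cover


/-- The basepoint: the center of the cube. -/
noncomputable def oo : CC := ⟨fun _ => 1 / 2, fun i => by norm_num, 0, by norm_num⟩

/-- Homotopy class of the image of a segment from the center to `p`. -/
noncomputable def tl (p : CC) {x : X} (h : pr p = x) : Path.Homotopic.Quotient (pr oo) x :=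
  .mk (((linPath oo p).map continuous_pr).cast rfl h.symm)

lemma tl_trans {a b : CC} {x y : X} (c : Path a b) (γ : Path x y) (h : ∀ t, γ t = pr (c t))
    (ha : pr a = x) (hb : pr b = y) : (tl a ha).trans (.mk γ) = tl b hb := by
  subst ha hb
  have e : γ = c.map continuous_pr := by
    apply Path.ext
    funext t
    exact h t
  subst e
  unfold tl
  rw [← Path.Homotopic.Quotient.mk_trans, Path.Homotopic.Quotient.eq]
  have := (SimplyConnectedSpace.paths_homotopic ((linPath oo a).trans c) (linPath oo b)).map
    ⟨pr, continuous_pr⟩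
  rw [Path.map_trans] at this
  exact this

lemma tl_oo : tl oo rfl = Path.Homotopic.Quotient.refl (pr oo) := by
  unfold tl
  rw [← Path.Homotopic.Quotient.mk_refl, Path.Homotopic.Quotient.eq]
  have := (SimplyConnectedSpace.paths_homotopic (linPath oo oo) (Path.refl oo)).map
    ⟨pr, continuous_pr⟩
  exact this

/-- The loop through the center associated with a pair of identified points. -/
noncomputable def MM (p q : CC) {x : X} (hp : pr p = x) (hq : pr q = x) :
    FundamentalGroup X (pr oo) := (tl p hp).trans (tl q hq).symm

lemma MM_self (p : CC) {x : X} (hp hq : pr p = x) : MM p p hp hq = 1 :=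
  Path.Homotopic.Quotient.trans_symm _

lemma MM_trans (p q r : CC) {x : X} (hp : pr p = x) (hq : pr q = x) (hr : pr r = x) :
    MM q r hq hr * MM p q hp hq = MM p r hp hr := by
  unfold MM
  rw [FundamentalGroup.mul_def, Path.Homotopic.Quotient.trans_assoc,
    ← Path.Homotopic.Quotient.trans_assoc _ (tl q hq),
    Path.Homotopic.Quotient.symm_trans, Path.Homotopic.Quotient.refl_trans]

lemma symm_trans_rev {x y z : X} (b : Path.Homotopic.Quotient x y)
    (c : Path.Homotopic.Quotient y z) : (b.trans c).symm = c.symm.trans b.symm := by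
  obtain ⟨b, rfl⟩ := Path.Homotopic.Quotient.mk_surjective b
  obtain ⟨c, rfl⟩ := Path.Homotopic.Quotient.mk_surjective c
  simp only [← Path.Homotopic.Quotient.mk_trans, ← Path.Homotopic.Quotient.mk_symm,
    Path.trans_symm]

lemma MM_R {k : Fin 3} {p q p' q' : CC} (h : R k p q) (h' : R k p' q') {x y : X}
    (hp : pr p = x) (hq : pr q = x) (hp' : pr p' = y) (hq' : pr q' = y) :
    MM p q hp hq = MM p' q' hp' hq' := by
  let γ : Path x y := ((linPath p p').map continuous_pr).cast hp.symm hp'.symm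
  have e1 := tl_trans (linPath p p') γ (fun _ => rfl) hp hp'
  have e2 := tl_trans (linPath q q') γ (fun t => pr_R (R_lin h h' t)) hq hq'
  unfold MM
  rw [← e1, ← e2]
  generalize tl p hp = a
  generalize tl q hq = b
  generalize Path.Homotopic.Quotient.mk γ = c
  rw [symm_trans_rev, Path.Homotopic.Quotient.trans_assoc, ← Path.Homotopic.Quotient.trans_assoc c,
    Path.Homotopic.Quotient.trans_symm, Path.Homotopic.Quotient.refl_trans]

lemma homotopic_of_mem {Y : Type*} [TopologicalSpace Y] {U : Set Y} (hU : SimplyConnectedSpace U)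
    {x y : Y} (γ γ' : Path x y) (h : ∀ t, γ t ∈ U) (h' : ∀ t, γ' t ∈ U) : γ.Homotopic γ' := by
  have hx : x ∈ U := by simpa using h 0
  have hy : y ∈ U := by simpa using h 1
  let δ : Path (⟨x, hx⟩ : U) ⟨y, hy⟩ := ⟨⟨fun t => ⟨γ t, h t⟩, by fun_prop⟩,
    Subtype.ext γ.source, Subtype.ext γ.target⟩
  let δ' : Path (⟨x, hx⟩ : U) ⟨y, hy⟩ := ⟨⟨fun t => ⟨γ' t, h' t⟩, by fun_prop⟩,
    Subtype.ext γ'.source, Subtype.ext γ'.target⟩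
  exact (SimplyConnectedSpace.paths_homotopic δ δ').map ⟨Subtype.val, continuous_subtype_val⟩

/-- The subgroup generated by face loops. -/
noncomputable def NN : Subgroup (FundamentalGroup X (pr oo)) :=
  Subgroup.closure {g | ∃ k p q, ∃ h : R k p q, g = MM p q (pr_R h) rfl}

lemma MM_mem (p q : CC) {x : X} (hp : pr p = x) (hq : pr q = x) : MM p q hp hq ∈ NN := by
  have key : ∀ {p q : CC} (_ : pr p = pr q), ∀ (x : X) (hp : pr p = x) (hq : pr q = x),
      MM p q hp hq ∈ NN := by
    intro p q h
    refine pr_ind (P := fun p q => ∀ (x : X) (hp : pr p = x) (hq : pr q = x),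
      MM p q hp hq ∈ NN) ?_ ?_ ?_ ?_ h
    · intro k p q h x hp hq
      subst hq
      exact Subgroup.subset_closure ⟨k, p, q, h, rfl⟩
    · intro p x hp hq
      rw [MM_self]
      exact one_mem _
    · intro p q ih x hp hq
      have := MM_trans q p q hp hq hp
      rw [MM_self] at this
      rw [eq_inv_of_mul_eq_one_right this]
      exact inv_mem (ih x hq hp)
    · intro p q r h1 h2 ih1 ih2 x hp hr
      rw [← MM_trans p q r hp (h1.symm.trans hp) hr]
      exact mul_mem (ih2 _ _ _) (ih1 _ _ _)
  exact key (hp.trans hq.symm) x hp hq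

/-- Path classes whose closed-up loops all lie in `NN`. -/
def Good {x y : X} (d : Path.Homotopic.Quotient x y) : Prop :=
  ∀ p q (hp : pr p = x) (hq : pr q = y),
    ((tl p hp).trans (d.trans (tl q hq).symm) : FundamentalGroup X (pr oo)) ∈ NN

lemma Good.trans {x y z : X} {d : Path.Homotopic.Quotient x y} {e : Path.Homotopic.Quotient y z}
    (hd : Good d) (he : Good e) : Good (d.trans e) := by
  intro p r hp hr
  obtain ⟨q, hq⟩ := isQuotientMap_pr.surjective y
  have := mul_mem (he q r hq hr) (hd p q hp hq)
  rw [FundamentalGroup.mul_def] at this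
  convert this using 1
  simp only [Path.Homotopic.Quotient.trans_assoc]
  rw [← Path.Homotopic.Quotient.trans_assoc _ (tl q hq),
    Path.Homotopic.Quotient.symm_trans, Path.Homotopic.Quotient.refl_trans]

lemma Good.refl (x : X) : Good (Path.Homotopic.Quotient.refl x) := by
  intro p q hp hq
  rw [Path.Homotopic.Quotient.refl_trans]
  exact MM_mem p q hp hq

lemma Good.star {ε S} (hn : Nice ε S) {p0 : CC} (h0 : CS S p0) {x y : X} (γ : Path x y)
    (h : ∀ t, γ t ∈ star ε (pr p0)) : Good (.mk γ) := by
  intro p' p'' hp' hp''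
  have hx : x ∈ X101.star ε (pr p0) := by simpa using h 0
  have hy : y ∈ X101.star ε (pr p0) := by simpa using h 1
  obtain ⟨p, h1, h2⟩ := (mem_star_iff hn h0 p').1 (hp' ▸ hx)
  obtain ⟨r, k1, k2⟩ := (mem_star_iff hn h0 p'').1 (hp'' ▸ hy)
  let γ1 : Path x (pr p0) := ((linPath p' p).map continuous_pr).cast hp'.symm h1.symm
  let γ2 : Path y (pr p0) := ((linPath p'' r).map continuous_pr).cast hp''.symm k1.symm
  have hγ1 : ∀ t, γ1 t ∈ X101.star ε (pr p0) := fun t =>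
    (mem_star_iff hn h0 _).2 ⟨p, h1, near_lin hn h2 t⟩
  have hγ2 : ∀ t, γ2 t ∈ X101.star ε (pr p0) := fun t =>
    (mem_star_iff hn h0 _).2 ⟨r, k1, near_lin hn k2 t⟩
  have hom : (γ.trans γ2).Homotopic γ1 := by
    refine homotopic_of_mem (simplyConnected_star hn h0) _ _ ?_ hγ1
    intro t
    have := mem_range_self (f := γ.trans γ2) t
    rw [Path.trans_range] at this
    rcases this with ⟨s, hs⟩ | ⟨s, hs⟩
    · rw [← hs]; exact h s
    · rw [← hs]; exact hγ2 s
  have e0 := Path.Homotopic.Quotient.eq.2 hom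
  rw [Path.Homotopic.Quotient.mk_trans] at e0
  have e1 := tl_trans (linPath p' p) γ1 (fun _ => rfl) hp' h1
  have e2 := tl_trans (linPath p'' r) γ2 (fun _ => rfl) hp'' k1
  have hM := MM_mem p r h1 k1
  unfold MM at hM
  rw [← e1, ← e2, ← e0] at hM
  convert hM using 1
  generalize tl p' hp' = a
  generalize tl p'' hp'' = b
  generalize Path.Homotopic.Quotient.mk γ = c
  generalize Path.Homotopic.Quotient.mk γ2 = d
  rw [symm_trans_rev]
  simp only [Path.Homotopic.Quotient.trans_assoc]
  rw [← Path.Homotopic.Quotient.trans_assoc d,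
    Path.Homotopic.Quotient.trans_symm, Path.Homotopic.Quotient.refl_trans]

lemma good_path {x y : X} (γ : Path x y) : Good (.mk γ) := by
  have hex : ∀ x : X, ∃ U : Set X, IsOpen U ∧ x ∈ U ∧
      ∀ (a b : X) (γ : Path a b), (∀ t, γ t ∈ U) → Good (.mk γ) := by
    intro x
    obtain ⟨p0, rfl⟩ := isQuotientMap_pr.surjective x
    obtain ⟨ε, S, hn, h0⟩ := exists_nice p0
    exact ⟨star ε (pr p0), isOpen_star hn h0, ⟨p0, p0, rfl, rfl, near_self hn p0⟩,
      fun a b γ h => Good.star hn h0 γ h⟩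
  choose U hUo hUm hU using hex
  obtain ⟨t, ht0, htm, ⟨n, hn⟩, ht⟩ := exists_monotone_Icc_subset_open_cover_unitInterval
    (c := fun x => γ ⁻¹' U x) (fun x => (hUo x).preimage γ.continuous)
    (fun s _ => mem_iUnion.2 ⟨γ s, hUm _⟩)
  have key : ∀ m, Good (.mk (γ.subpath 0 (t m))) := by
    intro m
    induction m with
    | zero =>
      rw [ht0, Path.subpath_self]
      exact Good.refl _
    | succ m ih =>
      have e := Path.Homotopic.Quotient.eq.2
        ⟨Path.Homotopy.subpathTransSubpath γ 0 (t m) (t (m + 1))⟩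
      rw [← e, Path.Homotopic.Quotient.mk_trans]
      refine ih.trans ?_
      obtain ⟨i, hi⟩ := ht m
      refine hU i _ _ _ fun s => ?_
      have := mem_range_self (f := γ.subpath (t m) (t (m + 1))) s
      rw [Path.range_subpath_of_le _ _ _ (htm (Nat.le_succ m))] at this
      obtain ⟨s', hs', e'⟩ := this
      rw [← e']
      exact hi hs'
  have h1 := key n
  rw [hn n le_rfl, Path.subpath_zero_one] at h1
  have : ∀ (x' y' : X) (hx : x' = x) (hy : y' = y), Good (.mk (γ.cast hx hy)) →
      Good (.mk γ) := by
    rintro _ _ rfl rfl h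
    exact h
  exact this _ _ _ _ h1

lemma NN_eq_top : NN = ⊤ := by
  rw [eq_top_iff]
  rintro g -
  obtain ⟨γ, rfl⟩ := Path.Homotopic.Quotient.mk_surjective (g : Path.Homotopic.Quotient _ _)
  have := good_path γ oo oo rfl rfl
  rw [tl_oo, Path.Homotopic.Quotient.refl_trans] at this
  convert this using 1
  have e : (Path.Homotopic.Quotient.refl (pr oo)).symm = Path.Homotopic.Quotient.refl (pr oo) := by
    rw [← Path.Homotopic.Quotient.mk_refl, ← Path.Homotopic.Quotient.mk_symm, Path.refl_symm]
  rw [e, Path.Homotopic.Quotient.trans_refl]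

/-- Support of the first component of the potential. -/
def P1 (p : CC) : Prop :=
  p.1 2 = 0 ∨ (p.1 0 = 0 ∧ p.1 1 = 1) ∨ (p.1 0 = 1 ∧ p.1 1 = 0)

/-- Support of the second component of the potential. -/
def P2 (p : CC) : Prop :=
  (p.1 1 = 1 ∧ p.1 0 ≠ 0) ∨ (p.1 0 = 1 ∧ p.1 1 = 0) ∨ (p.1 0 = 0 ∧ (p.1 2 = 0 ∨ p.1 2 = 1))

/-- Support of the third component of the potential. -/
def P3 (p : CC) : Prop :=
  (p.1 0 = 1 ∧ p.1 2 ≠ 0 ∧ p.1 2 ≠ 1) ∨ (p.1 0 = 0 ∧ (p.1 1 = 0 ∨ p.1 1 = 1))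

lemma nv_coords (p : CC) : (p.1 0 ≠ 0 ∧ p.1 0 ≠ 1) ∨ (p.1 1 ≠ 0 ∧ p.1 1 ≠ 1) ∨
    (p.1 2 ≠ 0 ∧ p.1 2 ≠ 1) := by
  rcases (NV_iff _).1 p.2.2 with h | h | h
  · exact Or.inl ⟨h.1.ne', h.2.ne⟩
  · exact Or.inr (Or.inl ⟨h.1.ne', h.2.ne⟩)
  · exact Or.inr (Or.inr ⟨h.1.ne', h.2.ne⟩)

lemma P_R0 {p q : CC} (h : R 0 p q) :
    (P1 q ∧ ¬ P1 p) ∧ (P2 q ↔ P2 p) ∧ (P3 q ↔ P3 p) := by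
  have hp := nv_coords p
  have hq := nv_coords q
  unfold P1 P2 P3
  simp only [R] at h
  grind

lemma P_R1 {p q : CC} (h : R 1 p q) :
    (P1 q ↔ P1 p) ∧ (P2 q ↔ ¬ P2 p) ∧ (P3 q ↔ P3 p) := by
  have hp := nv_coords p
  have hq := nv_coords q
  unfold P1 P2 P3
  simp only [R] at h
  grind

lemma P_R2 {p q : CC} (h : R 2 p q) :
    (P1 q ↔ P1 p) ∧ (P2 q ↔ P2 p) ∧ (P3 q ↔ ¬ P3 p) := by
  have hp := nv_coords p
  have hq := nv_coords q
  unfold P1 P2 P3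
  simp only [R] at h
  grind

/-- The target group. -/
abbrev GG : Type := Multiplicative (ℤ × ZMod 2 × ZMod 2)

open Classical in
/-- The potential. -/
noncomputable def phi (p : CC) : GG :=
  Multiplicative.ofAdd (if P1 p then 1 else 0, if P2 p then 1 else 0, if P3 p then 1 else 0)

/-- The weights of the three face pairings. -/
def ww : Fin 3 → GG :=
  ![Multiplicative.ofAdd (1, 0, 0), Multiplicative.ofAdd (0, 1, 0), Multiplicative.ofAdd (0, 0, 1)]

lemma phi_R (k : Fin 3) (p q : CC) (h : R k p q) : phi q = phi p * ww k := by
  unfold phi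
  have h2 : (0 : ZMod 2) = 1 + 1 := by decide
  fin_cases k
  · obtain ⟨⟨h1, h2⟩, h3, h4⟩ := P_R0 h
    change _ = Multiplicative.ofAdd (_ + (1, 0, 0))
    rw [if_pos h1, if_neg h2]
    by_cases h5 : P2 p <;> by_cases h6 : P3 p <;> simp [h5, h6, h3, h4]
  · obtain ⟨h1, h3, h4⟩ := P_R1 h
    change _ = Multiplicative.ofAdd (_ + (0, 1, 0))
    by_cases h5 : P2 p <;> by_cases h6 : P3 p <;> by_cases h7 : P1 p <;>
      simp [h5, h6, h7, h1, h3, h4, ← h2]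
  · obtain ⟨h1, h3, h4⟩ := P_R2 h
    change _ = Multiplicative.ofAdd (_ + (0, 0, 1))
    by_cases h5 : P2 p <;> by_cases h6 : P3 p <;> by_cases h7 : P1 p <;>
      simp [h5, h6, h7, h1, h3, h4, ← h2]

lemma phi_cov : IsQuotientCoveringMap (cov phi) GG := isQuotientCoveringMap_cov phi phi_R

/-- The basepoint of the cover. -/
noncomputable def ebase (s : GG) : cov phi ⁻¹' {pr oo} := ⟨kap phi (oo, s), rfl⟩

lemma monodromy_tl (p : CC) {x : X} (hp : pr p = x) (s : GG) :
    phi_cov.isCoveringMap.monodromy (tl p hp) (ebase s) = ⟨kap phi (p, s), hp⟩ := by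
  subst hp
  have hc : Continuous fun p : CC => kap phi (p, s) := by
    letI : TopologicalSpace GG := ⊥
    exact (isQuotientMap_kap phi).continuous.comp (continuous_id.prodMk continuous_const)
  let Γ : Path (kap phi (oo, s)) (kap phi (p, s)) := (linPath oo p).map hc
  exact phi_cov.isCoveringMap.monodromy_eq_of_map_eq (ex := ebase s)
    (ey := ⟨kap phi (p, s), rfl⟩) (.mk Γ) rfl

/-- The monodromy homomorphism. -/
noncomputable def HH : FundamentalGroup X (pr oo) →* GGᵐᵒᵖ :=
  phi_cov.fundamentalGroupToMulOpposite (ebase 1)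

lemma HH_R {k : Fin 3} {p q : CC} (h : R k p q) {x : X} (hp : pr p = x) (hq : pr q = x) :
    HH (MM p q hp hq) = MulOpposite.op (ww k) := by
  unfold HH
  rw [IsQuotientCoveringMap.fundamentalGroupToMulOpposite_apply_eq_Iff]
  have e1 : (⟨kap phi (p, 1), hp⟩ : cov phi ⁻¹' {x}) = ⟨kap phi (q, ww k), hq⟩ := by
    apply Subtype.ext
    refine Prod.ext (hp.trans hq.symm) ?_
    change 1 * (phi p)⁻¹ = ww k * (phi q)⁻¹
    rw [phi_R k p q h]
    simp
  have e2 : phi_cov.isCoveringMap.monodromy (MM p q hp hq) (ebase 1) = ebase (ww k) := by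
    unfold MM
    rw [IsCoveringMap.monodromy_trans_apply, monodromy_tl, e1, ← monodromy_tl q hq,
      ← IsCoveringMap.monodromy_trans_apply, Path.Homotopic.Quotient.trans_symm,
      IsCoveringMap.monodromy_refl]
    rfl
  rw [e2]
  change ww k • kap phi (oo, 1) = kap phi (oo, ww k)
  rw [smul_kap, mul_one]

/-- Abelianized fundamental group. -/
abbrev AA : Type := Abelianization (FundamentalGroup X (pr oo))

/-- Abelianized monodromy. -/
noncomputable def psi : AA →* GG :=
  Abelianization.lift ((MulEquiv.symm (MulOpposite.opMulEquiv (M := GG))).toMonoidHom.comp HH)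

lemma exists_R : ∀ k, ∃ p q, R k p q := by
  intro k
  fin_cases k
  · obtain ⟨p, h0, h1, h2⟩ := exists_pt (a := 1 / 2) (b := 0) (c := 1) (by norm_num)
      (by norm_num) (by norm_num) (by norm_num)
    obtain ⟨q, k0, k1, k2⟩ := exists_pt (a := 1) (b := 1 / 2) (c := 0) (by norm_num)
      (by norm_num) (by norm_num) (by norm_num)
    exact ⟨p, q, Or.inl ⟨rfl, by norm_num [*], by norm_num [*], by norm_num [*],
      by norm_num [*]⟩⟩
  · obtain ⟨p, h0, h1, h2⟩ := exists_pt (a := 1 / 2) (b := 0) (c := 1) (by norm_num)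
      (by norm_num) (by norm_num) (by norm_num)
    obtain ⟨q, k0, k1, k2⟩ := exists_pt (a := 1 / 2) (b := 1) (c := 1) (by norm_num)
      (by norm_num) (by norm_num) (by norm_num)
    exact ⟨p, q, Or.inr (Or.inl ⟨rfl, by norm_num [*], by norm_num [*], by norm_num [*],
      by norm_num [*]⟩)⟩
  · obtain ⟨p, h0, h1, h2⟩ := exists_pt (a := 0) (b := 1 / 2) (c := 1) (by norm_num)
      (by norm_num) (by norm_num) (by norm_num)
    obtain ⟨q, k0, k1, k2⟩ := exists_pt (a := 1) (b := 1) (c := 1 / 2) (by norm_num)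
      (by norm_num) (by norm_num) (by norm_num)
    exact ⟨p, q, Or.inr (Or.inr ⟨rfl, by norm_num [*], by norm_num [*], by norm_num [*],
      by norm_num [*]⟩)⟩

lemma exists_alpha : ∃ α : Fin 3 → AA,
    ∀ k p q (_ : R k p q) (x : X) (hp : pr p = x) (hq : pr q = x),
      Abelianization.of (MM p q hp hq) = α k := by
  have h := exists_R
  choose P Q hPQ using h
  refine ⟨fun k => Abelianization.of (MM (P k) (Q k) (pr_R (hPQ k)) rfl), ?_⟩
  intro k p q h x hp hq
  exact congrArg _ (MM_R h (hPQ k) _ _ _ _)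

/-- A point of the punctured cube with coordinates among 0, 1/2, 1. -/
lemma exists_half (a b c : Fin 3) (h : a = 1 ∨ b = 1 ∨ c = 1) :
    ∃ r : CC, r.1 0 = (a.1 : ℝ) / 2 ∧ r.1 1 = (b.1 : ℝ) / 2 ∧ r.1 2 = (c.1 : ℝ) / 2 := by
  have key : ∀ a : Fin 3, 0 ≤ (a.1 : ℝ) / 2 ∧ (a.1 : ℝ) / 2 ≤ 1 := by
    intro a; fin_cases a <;> norm_num
  refine exists_pt (key a) (key b) (key c) ?_
  rcases h with rfl | rfl | rfl
  · left; norm_num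
  · right; left; norm_num
  · right; right; norm_num

lemma relations {α : Fin 3 → AA}
    (hα : ∀ k p q (_ : R k p q) (x : X) (hp : pr p = x) (hq : pr q = x),
      Abelianization.of (MM p q hp hq) = α k) :
    (α 1 * α 2) ^ 2 = 1 ∧ α 2 ^ 2 = 1 := by
  have tr : ∀ (p q r : CC) (x : X) (hp : pr p = x) (hq : pr q = x) (hr : pr r = x),
      Abelianization.of (MM p r hp hr) =
        Abelianization.of (MM p q hp hq) * Abelianization.of (MM q r hq hr) := by
    intro p q r x hp hq hr
    rw [← MM_trans p q r hp hq hr, map_mul, mul_comm]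
  have sf : ∀ (p : CC) (x : X) (hp : pr p = x), Abelianization.of (MM p p hp hp) = 1 := by
    intro p x hp
    rw [MM_self, map_one]
  have sy : ∀ (p q : CC) (x : X) (hp : pr p = x) (hq : pr q = x),
      Abelianization.of (MM q p hq hp) = (Abelianization.of (MM p q hp hq))⁻¹ := by
    intro p q x hp hq
    rw [eq_inv_iff_mul_eq_one, ← tr, sf]
  obtain ⟨AB, hAB⟩ := exists_half 1 0 2 (by simp)
  obtain ⟨GF, hGF⟩ := exists_half 2 1 0 (by simp)
  obtain ⟨DH, hDH⟩ := exists_half 0 2 1 (by simp)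
  obtain ⟨BF, hBF⟩ := exists_half 2 0 1 (by simp)
  obtain ⟨HE, hHE⟩ := exists_half 0 1 0 (by simp)
  obtain ⟨CD, hCD⟩ := exists_half 1 2 2 (by simp)
  obtain ⟨BC, hBC⟩ := exists_half 2 1 2 (by simp)
  obtain ⟨FE, hFE⟩ := exists_half 1 0 0 (by simp)
  obtain ⟨HG, hHG⟩ := exists_half 1 2 0 (by simp)
  obtain ⟨DA, hDA⟩ := exists_half 0 1 2 (by simp)
  obtain ⟨CG, hCG⟩ := exists_half 2 2 1 (by simp)
  obtain ⟨EA, hEA⟩ := exists_half 0 0 1 (by simp)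
  have r1 : R 0 AB GF := by norm_num [R, *]
  have r2 : R 2 DH GF := by norm_num [R, *]
  have r3 : R 1 BF DH := by norm_num [R, *]
  have r4 : R 2 HE BF := by norm_num [R, *]
  have r5 : R 0 CD HE := by norm_num [R, *]
  have r6 : R 1 AB CD := by norm_num [R, *]
  have s1 : R 0 BC FE := by norm_num [R, *]
  have s2 : R 1 FE HG := by norm_num [R, *]
  have s3 : R 0 DA HG := by norm_num [R, *]
  have s4 : R 2 DA CG := by norm_num [R, *]
  have s5 : R 1 EA CG := by norm_num [R, *]
  have s6 : R 2 EA BC := by norm_num [R, *]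
  constructor
  · have a1 := pr_R r1
    have a2 := pr_R r2
    have a3 := pr_R r3
    have a4 := pr_R r4
    have a5 := pr_R r5
    have a6 := pr_R r6
    have c1 : pr AB = pr AB := rfl
    have c2 : pr GF = pr AB := a1.symm
    have c3 : pr DH = pr AB := a2.trans c2
    have c4 : pr BF = pr AB := a3.trans c3
    have c5 : pr HE = pr AB := a4.trans c4
    have c6 : pr CD = pr AB := a5.trans c5
    have := sf AB _ c1
    rw [tr AB GF AB _ c1 c2 c1, tr GF DH AB _ c2 c3 c1, tr DH BF AB _ c3 c4 c1,
      tr BF HE AB _ c4 c5 c1, tr HE CD AB _ c5 c6 c1, sy DH GF _ c3 c2, sy BF DH _ c4 c3,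
      sy HE BF _ c5 c4, sy CD HE _ c6 c5, sy AB CD _ c1 c6, hα _ _ _ r1, hα _ _ _ r2,
      hα _ _ _ r3, hα _ _ _ r4, hα _ _ _ r5, hα _ _ _ r6] at this
    rw [← inv_eq_one, ← this]
    simp only [pow_two, mul_inv_rev, mul_assoc, mul_comm, mul_left_comm]
    simp
  · have a1 := pr_R s1
    have a2 := pr_R s2
    have a3 := pr_R s3
    have a4 := pr_R s4
    have a5 := pr_R s5
    have a6 := pr_R s6
    have c1 : pr BC = pr BC := rfl
    have c2 : pr FE = pr BC := a1.symm
    have c3 : pr HG = pr BC := a2.symm.trans c2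
    have c4 : pr DA = pr BC := a3.trans c3
    have c5 : pr CG = pr BC := a4.symm.trans c4
    have c6 : pr EA = pr BC := a5.trans c5
    have := sf BC _ c1
    rw [tr BC FE BC _ c1 c2 c1, tr FE HG BC _ c2 c3 c1, tr HG DA BC _ c3 c4 c1,
      tr DA CG BC _ c4 c5 c1, tr CG EA BC _ c5 c6 c1, sy DA HG _ c4 c3, sy EA CG _ c6 c5,
      hα _ _ _ s1, hα _ _ _ s2,
      hα _ _ _ s3, hα _ _ _ s4, hα _ _ _ s5, hα _ _ _ s6] at this
    rw [mul_left_comm (α 1), mul_inv_cancel_left, mul_left_comm (α 2), mul_inv_cancel_left,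
      ← pow_two] at this
    exact this

lemma generation {α : Fin 3 → AA}
    (hα : ∀ k p q (_ : R k p q) (x : X) (hp : pr p = x) (hq : pr q = x),
      Abelianization.of (MM p q hp hq) = α k) (x : AA) :
    ∃ n i j : ℤ, x = α 0 ^ n * α 1 ^ i * α 2 ^ j := by
  obtain ⟨g, rfl⟩ := QuotientGroup.mk_surjective x
  change ∃ n i j : ℤ, Abelianization.of g = _
  have hg : g ∈ NN := by rw [NN_eq_top]; trivial
  induction hg using Subgroup.closure_induction with
  | mem g hg =>
    obtain ⟨k, p, q, h, rfl⟩ := hg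
    rw [hα k p q h]
    fin_cases k
    · exact ⟨1, 0, 0, by simp⟩
    · exact ⟨0, 1, 0, by simp⟩
    · exact ⟨0, 0, 1, by simp⟩
  | one => exact ⟨0, 0, 0, by rw [map_one]; simp⟩
  | mul a b _ _ iha ihb =>
    obtain ⟨n, i, j, h⟩ := iha
    obtain ⟨n', i', j', h'⟩ := ihb
    refine ⟨n + n', i + i', j + j', ?_⟩
    rw [map_mul, h, h']
    rw [zpow_add, zpow_add, zpow_add, mul_mul_mul_comm, mul_mul_mul_comm (α 0 ^ n)]
  | inv a _ iha =>
    obtain ⟨n, i, j, h⟩ := iha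
    refine ⟨-n, -i, -j, ?_⟩
    rw [map_inv, h]
    rw [mul_inv, mul_inv, zpow_neg, zpow_neg, zpow_neg]

lemma psi_alpha {α : Fin 3 → AA}
    (hα : ∀ k p q (_ : R k p q) (x : X) (hp : pr p = x) (hq : pr q = x),
      Abelianization.of (MM p q hp hq) = α k) (k : Fin 3) :
    psi (α k) = ww k := by
  obtain ⟨p, q, h⟩ := exists_R k
  rw [← hα k p q h _ (pr_R h) rfl]
  unfold psi
  rw [Abelianization.lift_apply_of]
  simp [HH_R h]

lemma psi_combo {α : Fin 3 → AA} (h : ∀ k, psi (α k) = ww k) (n i j : ℤ) :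
    psi (α 0 ^ n * α 1 ^ i * α 2 ^ j) = Multiplicative.ofAdd (n, (i : ZMod 2), (j : ZMod 2)) := by
  rw [map_mul, map_mul, map_zpow, map_zpow, map_zpow, h, h, h]
  change Multiplicative.ofAdd (n • ((1, 0, 0) : ℤ × ZMod 2 × ZMod 2) +
    i • ((0, 1, 0) : ℤ × ZMod 2 × ZMod 2) + j • ((0, 0, 1) : ℤ × ZMod 2 × ZMod 2)) = _
  simp

lemma psi_bijective : Function.Bijective psi := by
  obtain ⟨α, hα⟩ := exists_alpha
  have hψ := psi_alpha hα
  obtain ⟨r1, r2⟩ := relations hα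
  have r3 : α 1 ^ 2 = 1 := by
    rw [mul_pow, r2, mul_one] at r1
    exact r1
  constructor
  · rw [injective_iff_map_eq_one]
    intro x hx
    obtain ⟨n, i, j, rfl⟩ := generation hα x
    rw [psi_combo hψ] at hx
    have hx' : ((n, (i : ZMod 2), (j : ZMod 2)) : ℤ × ZMod 2 × ZMod 2) = (0, 0, 0) := hx
    simp only [Prod.mk.injEq] at hx'
    obtain ⟨hn, hi, hj⟩ := hx'
    rw [ZMod.intCast_zmod_eq_zero_iff_dvd] at hi hj
    obtain ⟨i, rfl⟩ := hi
    obtain ⟨j, rfl⟩ := hj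
    rw [hn, zpow_mul, zpow_mul]
    have r2' : α 2 ^ ((2 : ℕ) : ℤ) = 1 := by rw [zpow_natCast, r2]
    have r3' : α 1 ^ ((2 : ℕ) : ℤ) = 1 := by rw [zpow_natCast, r3]
    rw [r2', r3']
    simp
  · intro g
    obtain ⟨i, hi⟩ := ZMod.intCast_surjective (Multiplicative.toAdd g).2.1
    obtain ⟨j, hj⟩ := ZMod.intCast_surjective (Multiplicative.toAdd g).2.2
    refine ⟨α 0 ^ (Multiplicative.toAdd g).1 * α 1 ^ i * α 2 ^ j, ?_⟩
    rw [psi_combo hψ, hi, hj]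
    rfl

instance : PathConnectedSpace X :=
  isQuotientMap_pr.surjective.pathConnectedSpace continuous_pr

lemma main_iso (x0 : X) : Nonempty (Abelianization (FundamentalGroup X x0) ≃* GG) :=
  ⟨(FundamentalGroup.fundamentalGroupMulEquivOfPathConnected x0 (pr oo)).abelianizationCongr.trans
    (MulEquiv.ofBijective psi psi_bijective)⟩

end X101

/-- The abelianization of the fundamental group of `X` (its first integral
homology) is `ℤ × ℤ/2 × ℤ/2`. -/
theorem abelianization_fundamentalGroup_x101 :
    ∀ x0 : X,
      Nonempty (Abelianization (FundamentalGroup X x0) ≃*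
        Multiplicative (ℤ × ZMod 2 × ZMod 2)) := by
  exact fun x0 => X101.main_iso x0
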